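/- Let G be a group, let E be a complex Banach space, let π be a group homomorphism from G into the invertible bounded linear operators on E with M := sup_{x∈G} ‖π(x)‖ < ∞, and let ξ ∈ E and φ ∈ E* be such that ⟨π(x)ξ, φ⟩ ∈ {0,1} for every x ∈ G. If x₁, x₂ ∈ G satisfy ‖π(x₁)ξ − π(x₂)ξ‖ < 1/(M‖φ‖ + 1), then ⟨π(y x₁)ξ, φ⟩ = ⟨π(y x₂)ξ, φ⟩ for all y ∈ G. -/

import Mathlib

theorem coeff_zero_one_close_orbit_eq
    (G : Type) [Group G] (E : Type) [NormedAddCommGroup E] [NormedSpace ℂ E]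
    (π : G →* (E ≃L[ℂ] E)) (M : ℝ) (hM : ∀ x : G, ‖(π x : E →L[ℂ] E)‖ ≤ M)
    (ξ : E) (φ : E →L[ℂ] ℂ)
    (h01 : ∀ x : G, φ (π x ξ) = 0 ∨ φ (π x ξ) = 1)
    (x₁ x₂ : G) (hclose : ‖π x₁ ξ - π x₂ ξ‖ < 1 / (M * ‖φ‖ + 1)) :
    ∀ y : G, φ (π (y * x₁) ξ) = φ (π (y * x₂) ξ) := by
  intro y
  have hM0 : 0 ≤ M := (norm_nonneg _).trans (hM 1)
  have hpos : 0 < M * ‖φ‖ + 1 := by positivity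
  have hmul (x : G) : π (y * x) ξ = π y (π x ξ) := by rw [map_mul]; rfl
  have hπ : ‖π y (π x₁ ξ - π x₂ ξ)‖ ≤ M * ‖π x₁ ξ - π x₂ ξ‖ :=
    (π y : E →L[ℂ] E).le_of_opNorm_le (hM y) _
  have hlt : ‖φ (π (y * x₁) ξ) - φ (π (y * x₂) ξ)‖ < 1 := by
    rw [hmul, hmul, ← map_sub, ← map_sub]
    rw [lt_div_iff₀ hpos] at hclose
    have hφ := φ.le_opNorm (π y (π x₁ ξ - π x₂ ξ))
    have hφπ := mul_le_mul_of_nonneg_left hπ (norm_nonneg φ)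
    nlinarith [norm_nonneg (π x₁ ξ - π x₂ ξ)]
  rcases h01 (y * x₁) with h₁ | h₁ <;> rcases h01 (y * x₂) with h₂ | h₂ <;>
    rw [h₁, h₂] at hlt ⊢ <;> norm_num at hlt
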